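/- Convergence of the univariate PN subdivision scheme (second assertion of Theorem 1): let a : ℤ → ℝ be a mask supported in {−B,…,B} with Σ_j a_{2j} = Σ_j a_{2j+1} = 1, and assume the linear scheme S_a is convergent (C⁰), i.e. for every bounded f⁰ : ℤ → ℝ^d there exists a continuous F : ℝ → ℝ^d such that lim_{k→∞} sup_{i∈ℤ} ‖(S_a^k f⁰)_i − F(2^{−k} i)‖ = 0. Let n^k : ℤ → ℝ^d (k ∈ ℕ) be sequences of unit vectors satisfying ‖n_j^k − n_l^k‖ ≤ c₁ γ^k whenever |j − l| ≤ 2B (with c₁ > 0, 0 < γ < 1) and ⟨n_i^{k+1}, n_j^k⟩ ≥ 0 whenever a_{i−2j} ≠ 0, and define A_{ij}^k = A(n_i^{k+1}, n_j^k) and M_{ij}^k = I + Σ_{l∈ℤ} a_{i−2l}(A_{ij}^k − A_{il}^k). Then for every bounded initial sequence p⁰ : ℤ → ℝ^d, the PN subdivision sequence defined by p_i^{k+1} = Σ_{j∈ℤ} a_{i−2j} M_{ij}^k p_j^k converges: there exists a continuous P : ℝ → ℝ^d with lim_{k→∞} sup_{i∈ℤ} ‖p_i^k − P(2^{−k} i)‖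 = 0. -/

import Mathlib

open scoped RealInnerProductSpace BigOperators

noncomputable section

variable {d : ℕ}

/-- The projection map `A(X₁, X₂) : v ↦ (⟨X₁ + X₂, v⟩ / ⟨X₁ + X₂, X₁⟩) · X₁`. -/
def Amap (X₁ X₂ : EuclideanSpace ℝ (Fin d)) :
    EuclideanSpace ℝ (Fin d) →L[ℝ] EuclideanSpace ℝ (Fin d) :=
  (⟪X₁ + X₂, X₁⟫)⁻¹ • (innerSL ℝ (X₁ + X₂)).smulRight X₁

/-- `A_{ij}^k = A(n_i^{k+1}, n_j^k)` for the subdivided normals `n^k`. -/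
def pnA (n : ℕ → ℤ → EuclideanSpace ℝ (Fin d)) (k : ℕ) (i j : ℤ) :
    EuclideanSpace ℝ (Fin d) →L[ℝ] EuclideanSpace ℝ (Fin d) :=
  Amap (n (k + 1) i) (n k j)

/-- The PN perturbation matrices `M_{ij}^k = I + Σ_l a_{i-2l}(A_{ij}^k − A_{il}^k)`. -/
def pnM (a : ℤ → ℝ) (n : ℕ → ℤ → EuclideanSpace ℝ (Fin d)) (k : ℕ) (i j : ℤ) :
    EuclideanSpace ℝ (Fin d) →L[ℝ] EuclideanSpace ℝ (Fin d) :=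
  1 + ∑ᶠ l : ℤ, a (i - 2 * l) • (pnA n k i j - pnA n k i l)

/-- The linear subdivision operator `(S_a p)_i = Σ_j a_{i−2j} p_j`. -/
def Sop (a : ℤ → ℝ) (p : ℤ → EuclideanSpace ℝ (Fin d)) : ℤ → EuclideanSpace ℝ (Fin d) :=
  fun i => ∑ᶠ j : ℤ, a (i - 2 * j) • p j

/-- The indices `j` contributing to the `i`-th subdivided point after `k` steps lie in this
window, whose size does not depend on `i` and `k`. -/
def stencil (B : ℕ) (k : ℕ) (i : ℤ) : Finset ℤ :=
  Finset.Icc (i / 2 ^ k - (B + 1)) (i / 2 ^ k + (B + 1))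

theorem card_stencil (B k : ℕ) (i : ℤ) : (stencil B k i).card = 2 * B + 3 := by
  simp only [stencil, Int.card_Icc]
  omega

theorem mem_stencil {B k : ℕ} {i j : ℤ} (h : |i - 2 ^ k * j| ≤ B * 2 ^ k) :
    j ∈ stencil B k i := by
  have hpos : (0 : ℤ) < 2 ^ k := by positivity
  have hdiv := Int.mul_ediv_add_emod i (2 ^ k)
  have h0 := Int.emod_nonneg i hpos.ne'
  have h1 := Int.emod_lt_of_pos i hpos
  rw [abs_le] at h
  rw [stencil, Finset.mem_Icc]
  constructor
  · by_contra! hlt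
    nlinarith [mul_le_mul_of_nonneg_left (Int.add_one_le_of_lt hlt) hpos.le]
  · by_contra! hlt
    nlinarith [mul_le_mul_of_nonneg_left (Int.add_one_le_of_lt hlt) hpos.le]

section Mask

variable {B : ℕ} {a : ℤ → ℝ}

theorem mem_stencil_one (hsupp : ∀ i : ℤ, a i ≠ 0 → |i| ≤ (B : ℤ)) {i j : ℤ}
    (h : a (i - 2 * j) ≠ 0) : j ∈ stencil B 1 i := by
  apply mem_stencil
  have := hsupp _ h
  rw [pow_one]
  linarith [Int.natCast_nonneg B]

theorem support_mask_smul_subset {V : Type*} [AddCommGroup V] [Module ℝ V]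
    (hsupp : ∀ i : ℤ, a i ≠ 0 → |i| ≤ (B : ℤ)) (i : ℤ) (g : ℤ → V) :
    Function.support (fun j => a (i - 2 * j) • g j) ⊆ stencil B 1 i := by
  intro j hj
  exact mem_stencil_one hsupp (left_ne_zero_of_smul hj)

theorem finite_support_mask_smul {V : Type*} [AddCommGroup V] [Module ℝ V]
    (hsupp : ∀ i : ℤ, a i ≠ 0 → |i| ≤ (B : ℤ)) (i : ℤ) (g : ℤ → V) :
    (Function.support (fun j => a (i - 2 * j) • g j)).Finite :=
  (stencil B 1 i).finite_toSet.subset (support_mask_smul_subset hsupp i g)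

/-- A bound for the norm of one linear subdivision step. -/
def maskBound (B : ℕ) (a : ℤ → ℝ) : ℝ :=
  1 + (2 * B + 3) * ∑ m ∈ Finset.Icc (-(B : ℤ)) B, |a m|

theorem one_le_maskBound (B : ℕ) (a : ℤ → ℝ) : 1 ≤ maskBound B a := by
  have : 0 ≤ ∑ m ∈ Finset.Icc (-(B : ℤ)) B, |a m| := Finset.sum_nonneg fun _ _ => abs_nonneg _
  unfold maskBound
  nlinarith [mul_nonneg (by positivity : (0 : ℝ) ≤ 2 * B + 3) this]

theorem norm_finsum_mask_smul_le {V : Type*} [NormedAddCommGroup V] [NormedSpace ℝ V]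
    (hsupp : ∀ i : ℤ, a i ≠ 0 → |i| ≤ (B : ℤ)) {i : ℤ} {g : ℤ → V} {C : ℝ} (hC : 0 ≤ C)
    (hg : ∀ j, a (i - 2 * j) ≠ 0 → ‖g j‖ ≤ C) :
    ‖∑ᶠ j : ℤ, a (i - 2 * j) • g j‖ ≤ maskBound B a * C := by
  set s : ℝ := ∑ m ∈ Finset.Icc (-(B : ℤ)) B, |a m| with hs
  have hs0 : 0 ≤ s := Finset.sum_nonneg fun _ _ => abs_nonneg _
  rw [finsum_eq_sum_of_support_subset _ (support_mask_smul_subset hsupp i g)]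
  have hterm : ∀ j ∈ stencil B 1 i, ‖a (i - 2 * j) • g j‖ ≤ s * C := by
    intro j _
    by_cases h : a (i - 2 * j) = 0
    · simpa [h] using mul_nonneg hs0 hC
    · rw [norm_smul, Real.norm_eq_abs]
      have hle : |a (i - 2 * j)| ≤ s :=
        Finset.single_le_sum (f := fun m => |a m|) (fun _ _ => abs_nonneg _)
          (Finset.mem_Icc.2 (abs_le.1 (hsupp _ h)))
      exact mul_le_mul hle (hg j h) (norm_nonneg _) hs0
  have hsum := norm_sum_le_of_le _ hterm
  rw [Finset.sum_const, card_stencil, nsmul_eq_mul] at hsum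
  refine hsum.trans ?_
  unfold maskBound
  push_cast
  nlinarith

/-- The linear subdivision operator as a linear map. -/
def SopLin (hsupp : ∀ i : ℤ, a i ≠ 0 → |i| ≤ (B : ℤ)) :
    Module.End ℝ (ℤ → EuclideanSpace ℝ (Fin d)) where
  toFun := Sop a
  map_add' f g := by
    ext1 i
    simp only [Sop, Pi.add_apply, smul_add]
    exact finsum_add_distrib (finite_support_mask_smul hsupp i f)
      (finite_support_mask_smul hsupp i g)
  map_smul' c f := by
    ext1 i
    simp only [Sop, Pi.smul_apply, RingHom.id_apply, smul_comm _ c]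
    exact (smul_finsum c _).symm

theorem SopLin_pow_apply (hsupp : ∀ i : ℤ, a i ≠ 0 → |i| ≤ (B : ℤ)) (k : ℕ)
    (f : ℤ → EuclideanSpace ℝ (Fin d)) : (SopLin hsupp ^ k) f = (Sop a)^[k] f :=
  Module.End.pow_apply _ _ _

theorem norm_SopLin_pow_le (hsupp : ∀ i : ℤ, a i ≠ 0 → |i| ≤ (B : ℤ)) (k : ℕ)
    {f : ℤ → EuclideanSpace ℝ (Fin d)} {C : ℝ} (hf : ∀ i, ‖f i‖ ≤ C) (i : ℤ) :
    ‖(SopLin hsupp ^ k) f i‖ ≤ maskBound B a ^ k * C := by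
  have hC : 0 ≤ C := (norm_nonneg _).trans (hf 0)
  have hR : 0 ≤ maskBound B a := zero_le_one.trans (one_le_maskBound B a)
  induction k generalizing i with
  | zero => simpa using hf i
  | succ k ih =>
    rw [pow_succ', pow_succ', mul_assoc]
    exact norm_finsum_mask_smul_le hsupp (mul_nonneg (pow_nonneg hR k) hC) fun j _ => ih j

theorem SopLin_pow_congr (hsupp : ∀ i : ℤ, a i ≠ 0 → |i| ≤ (B : ℤ)) (k : ℕ)
    {f g : ℤ → EuclideanSpace ℝ (Fin d)} {i : ℤ}
    (h : ∀ j, |i - 2 ^ k * j| + B ≤ B * 2 ^ k → f j = g j) :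
    (SopLin hsupp ^ k) f i = (SopLin hsupp ^ k) g i := by
  induction k generalizing f g with
  | zero => simpa using h i (by simp)
  | succ k ih =>
    rw [pow_succ]
    refine ih fun l hl => finsum_congr fun j => ?_
    by_cases haj : a (l - 2 * j) = 0
    · simp [haj]
    · have hb := hsupp _ haj
      rw [h j]
      have hpos : (0 : ℤ) < 2 ^ k := by positivity
      have hsplit : i - 2 ^ (k + 1) * j = (i - 2 ^ k * l) + 2 ^ k * (l - 2 * j) := by ring
      have htri := abs_add_le (i - 2 ^ k * l) (2 ^ k * (l - 2 * j))
      rw [abs_mul, abs_of_pos hpos] at htri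
      rw [hsplit, pow_succ]
      nlinarith [mul_le_mul_of_nonneg_left hb hpos.le]

theorem SopLin_pow_shift (hsupp : ∀ i : ℤ, a i ≠ 0 → |i| ≤ (B : ℤ)) (k : ℕ)
    (f : ℤ → EuclideanSpace ℝ (Fin d)) (m i : ℤ) :
    (SopLin hsupp ^ k) (fun j => f (j - m)) i = (SopLin hsupp ^ k) f (i - 2 ^ k * m) := by
  induction k generalizing i with
  | zero => simp
  | succ k ih =>
    rw [pow_succ']
    change (∑ᶠ j : ℤ, a (i - 2 * j) • (SopLin hsupp ^ k) (fun j => f (j - m)) j)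
      = ∑ᶠ j : ℤ, a (i - 2 ^ (k + 1) * m - 2 * j) • (SopLin hsupp ^ k) f j
    refine Eq.trans (finsum_congr fun j => ?_) (finsum_comp_equiv (Equiv.subRight (2 ^ k * m)))
    rw [ih, Equiv.subRight_apply]
    congr 2
    ring

theorem SopLin_pow_map (hsupp : ∀ i : ℤ, a i ≠ 0 → |i| ≤ (B : ℤ)) (k : ℕ)
    (L : EuclideanSpace ℝ (Fin d) →ₗ[ℝ] EuclideanSpace ℝ (Fin d))
    (f : ℤ → EuclideanSpace ℝ (Fin d)) (i : ℤ) :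
    (SopLin hsupp ^ k) (fun j => L (f j)) i = L ((SopLin hsupp ^ k) f i) := by
  induction k generalizing i with
  | zero => simp
  | succ k ih =>
    rw [pow_succ']
    change (∑ᶠ j : ℤ, a (i - 2 * j) • (SopLin hsupp ^ k) (fun j => L (f j)) j)
      = L (∑ᶠ j : ℤ, a (i - 2 * j) • (SopLin hsupp ^ k) f j)
    rw [map_finsum L (finite_support_mask_smul hsupp i ((SopLin hsupp ^ k) f))]
    exact finsum_congr fun j => by rw [ih, map_smul]

/-- Powers of the subdivision operator are controlled by the impulse responses. -/
theorem norm_SopLin_pow_le_of_single (hsupp : ∀ i : ℤ, a i ≠ 0 → |i| ≤ (B : ℤ)) {C : ℝ}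
    (hC : ∀ (k : ℕ) (i : ℤ) (v : EuclideanSpace ℝ (Fin d)),
      ‖(SopLin hsupp ^ k) (Pi.single 0 v) i‖ ≤ C * ‖v‖) (hC0 : 0 ≤ C) (k : ℕ)
    {f : ℤ → EuclideanSpace ℝ (Fin d)} {D : ℝ} (hf : ∀ i, ‖f i‖ ≤ D) (i : ℤ) :
    ‖(SopLin hsupp ^ k) f i‖ ≤ (2 * B + 3) * C * D := by
  have hcongr : (SopLin hsupp ^ k) f i
      = (SopLin hsupp ^ k) (∑ m ∈ stencil B k i, Pi.single m (f m)) i := by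
    refine SopLin_pow_congr hsupp k fun j hj => ?_
    have hmem : j ∈ stencil B k i := mem_stencil (by linarith [Int.natCast_nonneg B])
    simp [Finset.sum_apply, Pi.single_apply, hmem]
  rw [hcongr, map_sum, Finset.sum_apply]
  have hterm : ∀ m ∈ stencil B k i, ‖(SopLin hsupp ^ k) (Pi.single m (f m)) i‖ ≤ C * D := by
    intro m _
    have hshift : (Pi.single m (f m) : ℤ → EuclideanSpace ℝ (Fin d))
        = fun j => (Pi.single 0 (f m) : ℤ → EuclideanSpace ℝ (Fin d)) (j - m) := by
      ext1 j
      simp [Pi.single_apply, sub_eq_zero]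
    rw [hshift, SopLin_pow_shift]
    exact (hC k _ _).trans (mul_le_mul_of_nonneg_left (hf m) hC0)
  refine (norm_sum_le_of_le _ hterm).trans_eq ?_
  rw [Finset.sum_const, card_stencil, nsmul_eq_mul]
  push_cast
  ring

/-- The powers of a convergent subdivision operator are uniformly bounded. -/
theorem exists_norm_SopLin_pow_le (hsupp : ∀ i : ℤ, a i ≠ 0 → |i| ≤ (B : ℤ))
    (hconv : ∀ f0 : ℤ → EuclideanSpace ℝ (Fin d), (∃ C : ℝ, ∀ i : ℤ, ‖f0 i‖ ≤ C) →
      ∃ F : ℝ → EuclideanSpace ℝ (Fin d), Continuous F ∧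
        ∀ ε > (0 : ℝ), ∃ K : ℕ, ∀ k ≥ K, ∀ i : ℤ,
          ‖(Sop a)^[k] f0 i - F ((i : ℝ) / 2 ^ k)‖ ≤ ε)
    {e : EuclideanSpace ℝ (Fin d)} (he : ‖e‖ = 1) :
    ∃ K : ℝ, 0 ≤ K ∧ ∀ (k : ℕ) (f : ℤ → EuclideanSpace ℝ (Fin d)) (D : ℝ),
      (∀ i, ‖f i‖ ≤ D) → ∀ i, ‖(SopLin hsupp ^ k) f i‖ ≤ K * D := by
  have hδ : ∀ i, ‖(Pi.single 0 e : ℤ → EuclideanSpace ℝ (Fin d)) i‖ ≤ 1 := by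
    intro i
    by_cases h : i = 0 <;> simp [h, he]
  obtain ⟨F, hF, hlim⟩ := hconv _ ⟨1, hδ⟩
  obtain ⟨N, hN⟩ := hlim 1 one_pos
  obtain ⟨c, hc⟩ := (isCompact_Icc (a := -(B : ℝ)) (b := B)).exists_bound_of_continuousOn
    hF.continuousOn
  have hc0 : 0 ≤ c := (norm_nonneg _).trans (hc 0 (by simp))
  have hR : 0 ≤ maskBound B a ^ N :=
    pow_nonneg (zero_le_one.trans (one_le_maskBound B a)) N
  set C : ℝ := 1 + c + maskBound B a ^ N with hCdef
  have hC0 : 0 ≤ C := by positivity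
  have hzero : ∀ (k : ℕ) (i : ℤ), ¬ |i| ≤ B * 2 ^ k →
      (SopLin hsupp ^ k) (Pi.single 0 e) i = 0 := by
    intro k i hi
    have : (SopLin hsupp ^ k) (Pi.single 0 e) i
        = (SopLin hsupp ^ k) (0 : ℤ → EuclideanSpace ℝ (Fin d)) i := by
      refine SopLin_pow_congr hsupp k fun j hj => ?_
      have hj0 : j ≠ 0 := by
        rintro rfl
        rw [mul_zero, sub_zero] at hj
        exact hi (by linarith [Int.natCast_nonneg B])
      simp [hj0]
    rw [this, map_zero, Pi.zero_apply]
  have hunitary : ∀ (k : ℕ) (i : ℤ), ‖(SopLin hsupp ^ k) (Pi.single 0 e) i‖ ≤ C := by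
    intro k i
    by_cases hi : |i| ≤ B * 2 ^ k
    · rcases le_total N k with hk | hk
      · have h1 := hN k hk i
        rw [← SopLin_pow_apply hsupp] at h1
        have hmem : (i : ℝ) / 2 ^ k ∈ Set.Icc (-(B : ℝ)) B := by
          rw [Set.mem_Icc, ← abs_le, abs_div, abs_of_pos (by positivity : (0 : ℝ) < 2 ^ k),
            div_le_iff₀ (by positivity)]
          exact_mod_cast hi
        have h2 := hc _ hmem
        have h3 := norm_le_norm_add_norm_sub' ((SopLin hsupp ^ k) (Pi.single 0 e) i)
          (F ((i : ℝ) / 2 ^ k))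
        linarith
      · have h1 := norm_SopLin_pow_le hsupp k hδ i
        have h2 := pow_le_pow_right₀ (one_le_maskBound B a) hk
        linarith
    · rw [hzero k i hi, norm_zero]
      exact hC0
  have hsingle : ∀ (k : ℕ) (i : ℤ) (v : EuclideanSpace ℝ (Fin d)),
      ‖(SopLin hsupp ^ k) (Pi.single 0 v) i‖ ≤ C * ‖v‖ := by
    intro k i v
    let L : EuclideanSpace ℝ (Fin d) →L[ℝ] EuclideanSpace ℝ (Fin d) :=
      (innerSL ℝ e).smulRight v
    have hL : ∀ x, L x = ⟪e, x⟫ • v := fun x => by simp [L]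
    have hv : (Pi.single 0 v : ℤ → EuclideanSpace ℝ (Fin d))
        = fun j => L.toLinearMap ((Pi.single 0 e : ℤ → EuclideanSpace ℝ (Fin d)) j) := by
      ext1 j
      by_cases h : j = 0
      · subst h
        simp [hL, he]
      · simp [h]
    rw [hv, SopLin_pow_map, ContinuousLinearMap.coe_coe, hL, norm_smul]
    refine mul_le_mul_of_nonneg_right ?_ (norm_nonneg v)
    calc ‖⟪e, (SopLin hsupp ^ k) (Pi.single 0 e) i⟫‖
        ≤ ‖e‖ * ‖(SopLin hsupp ^ k) (Pi.single 0 e) i‖ := norm_inner_le_norm _ _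
      _ ≤ C := by rw [he, one_mul]; exact hunitary k i
  exact ⟨(2 * B + 3) * C, by positivity, fun k f D hf i =>
    norm_SopLin_pow_le_of_single hsupp hsingle hC0 k hf i⟩

end Mask

theorem norm_Amap_sub_Amap_le {x y z : EuclideanSpace ℝ (Fin d)} (hx : ‖x‖ = 1)
    (hz : ‖z‖ = 1) (hxy : 0 ≤ ⟪x, y⟫) (hxz : 0 ≤ ⟪x, z⟫) :
    ‖Amap x y - Amap x z‖ ≤ 3 * ‖y - z‖ := by
  refine ContinuousLinearMap.opNorm_le_bound _ (by positivity) fun v => ?_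
  have hself : ⟪x, x⟫ = 1 := by rw [real_inner_self_eq_norm_sq, hx, one_pow]
  have hb : ⟪x + y, x⟫ = 1 + ⟪x, y⟫ := by rw [inner_add_left, hself, real_inner_comm]
  have hb' : ⟪x + z, x⟫ = 1 + ⟪x, z⟫ := by rw [inner_add_left, hself, real_inner_comm]
  set b : ℝ := 1 + ⟪x, y⟫ with hbdef
  set b' : ℝ := 1 + ⟪x, z⟫ with hbdef'
  have hb1 : 1 ≤ b := by linarith
  have hb1' : 1 ≤ b' := by linarith
  have happ : (Amap x y - Amap x z) v = (b⁻¹ * ⟪x + y, v⟫ - b'⁻¹ * ⟪x + z, v⟫) • x := by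
    simp only [Amap, sub_apply, smul_apply,
      ContinuousLinearMap.smulRight_apply, innerSL_apply_apply, hb, hb', smul_smul, sub_smul]
  have hsplit : b⁻¹ * ⟪x + y, v⟫ - b'⁻¹ * ⟪x + z, v⟫
      = b⁻¹ * (⟪y - z, v⟫ - b'⁻¹ * ⟪x + z, v⟫ * ⟪x, y - z⟫) := by
    have h1 : ⟪y - z, v⟫ = ⟪x + y, v⟫ - ⟪x + z, v⟫ := by
      simp only [inner_add_left, inner_sub_left]; ring
    have h2 : ⟪x, y - z⟫ = b - b' := by rw [inner_sub_right]; ring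
    rw [h1, h2]
    field_simp
    ring
  have h1 : |⟪y - z, v⟫| ≤ ‖y - z‖ * ‖v‖ := abs_real_inner_le_norm _ _
  have h2 : |⟪x, y - z⟫| ≤ ‖y - z‖ := by
    simpa [hx] using abs_real_inner_le_norm x (y - z)
  have h3 : |⟪x + z, v⟫| ≤ 2 * ‖v‖ := by
    refine (abs_real_inner_le_norm _ _).trans (mul_le_mul_of_nonneg_right ?_ (norm_nonneg v))
    linarith [norm_add_le x z]
  have hinv : |b⁻¹| ≤ 1 := by
    rw [abs_of_pos (by positivity)]; exact inv_le_one_of_one_le₀ hb1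
  have hinv' : |b'⁻¹| ≤ 1 := by
    rw [abs_of_pos (by positivity)]; exact inv_le_one_of_one_le₀ hb1'
  rw [happ, norm_smul, hx, mul_one, hsplit, Real.norm_eq_abs, abs_mul]
  have h4 : |b'⁻¹ * ⟪x + z, v⟫ * ⟪x, y - z⟫| ≤ 1 * (2 * ‖v‖) * ‖y - z‖ := by
    rw [abs_mul, abs_mul]
    gcongr
  calc |b⁻¹| * |⟪y - z, v⟫ - b'⁻¹ * ⟪x + z, v⟫ * ⟪x, y - z⟫|
      ≤ 1 * |⟪y - z, v⟫ - b'⁻¹ * ⟪x + z, v⟫ * ⟪x, y - z⟫| :=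
        mul_le_mul_of_nonneg_right hinv (abs_nonneg _)
    _ ≤ |⟪y - z, v⟫| + |b'⁻¹ * ⟪x + z, v⟫ * ⟪x, y - z⟫| := by
        rw [one_mul]; exact abs_sub _ _
    _ ≤ 3 * ‖y - z‖ * ‖v‖ := by linarith

/-- One PN step is a perturbation of the linear step, geometrically small in the level. -/
theorem norm_finsum_pnM_sub_Sop_le {B : ℕ} {a : ℤ → ℝ}
    (hsupp : ∀ i : ℤ, a i ≠ 0 → |i| ≤ (B : ℤ))
    {n : ℕ → ℤ → EuclideanSpace ℝ (Fin d)} (hunit : ∀ (k : ℕ) (j : ℤ), ‖n k j‖ = 1)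
    {δ : ℝ} (k : ℕ) (hclose : ∀ j l : ℤ, |j - l| ≤ 2 * (B : ℤ) → ‖n k j - n k l‖ ≤ δ)
    (hinner : ∀ i j : ℤ, a (i - 2 * j) ≠ 0 → 0 ≤ ⟪n (k + 1) i, n k j⟫)
    {q : ℤ → EuclideanSpace ℝ (Fin d)} {D : ℝ} (hq : ∀ j, ‖q j‖ ≤ D) (i : ℤ) :
    ‖∑ᶠ j : ℤ, a (i - 2 * j) • pnM a n k i j (q j) - Sop a q i‖
      ≤ 3 * maskBound B a ^ 2 * δ * D := by
  have hR : 0 ≤ maskBound B a := zero_le_one.trans (one_le_maskBound B a)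
  have hD : 0 ≤ D := (norm_nonneg _).trans (hq 0)
  have hδ : 0 ≤ δ := (norm_nonneg _).trans (hclose 0 0 (by simp))
  have hM : ∀ j, a (i - 2 * j) ≠ 0 → ‖pnM a n k i j - 1‖ ≤ maskBound B a * (3 * δ) := by
    intro j hj
    rw [pnM, add_sub_cancel_left]
    refine norm_finsum_mask_smul_le
      (V := EuclideanSpace ℝ (Fin d) →L[ℝ] EuclideanSpace ℝ (Fin d)) hsupp
      (g := fun l => pnA n k i j - pnA n k i l) (by positivity) fun l hl => ?_
    refine (norm_Amap_sub_Amap_le (hunit _ _) (hunit _ _) (hinner i j hj)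
      (hinner i l hl)).trans ?_
    have hjl : |j - l| ≤ 2 * (B : ℤ) := by
      have h1 := abs_le.1 (hsupp _ hj)
      have h2 := abs_le.1 (hsupp _ hl)
      rw [abs_le]
      omega
    linarith [hclose j l hjl]
  rw [Sop, ← finsum_sub_distrib (finite_support_mask_smul hsupp i fun j => pnM a n k i j (q j))
    (finite_support_mask_smul hsupp i q)]
  simp only [← smul_sub]
  refine (norm_finsum_mask_smul_le (V := EuclideanSpace ℝ (Fin d)) hsupp
    (g := fun j => pnM a n k i j (q j) - q j) (C := maskBound B a * (3 * δ) * D) (by positivity)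
    fun j hj => ?_).trans_eq (by ring)
  have : pnM a n k i j (q j) - q j = (pnM a n k i j - 1) (q j) := by simp
  rw [this]
  exact ((pnM a n k i j - 1).le_opNorm _).trans
    (mul_le_mul (hM j hj) (hq j) (norm_nonneg _) (by positivity))

/-- A perturbed iteration of a power-bounded operator with summable relative perturbations
stays bounded. -/
theorem exists_bound_of_perturbed_iteration {E : Type*} [NormedAddCommGroup E] [NormedSpace ℝ E]
    {T : Module.End ℝ (ℤ → E)} {K : ℝ} (hK : 0 ≤ K)
    (hT : ∀ (k : ℕ) (f : ℤ → E) (D : ℝ), (∀ i, ‖f i‖ ≤ D) → ∀ i, ‖(T ^ k) f i‖ ≤ K * D)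
    {p : ℕ → ℤ → E} {c γ : ℝ} (hc : 0 ≤ c) (hγ₀ : 0 < γ) (hγ₁ : γ < 1)
    (hp : ∀ (k : ℕ) (D : ℝ), (∀ j, ‖p k j‖ ≤ D) → ∀ i, ‖(p (k + 1) - T (p k)) i‖ ≤ c * γ ^ k * D)
    (hbdd : ∃ C : ℝ, ∀ i, ‖p 0 i‖ ≤ C) :
    ∃ D : ℝ, ∀ k i, ‖p k i‖ ≤ D := by
  obtain ⟨C, hC⟩ := hbdd
  have hC0 : 0 ≤ C := (norm_nonneg _).trans (hC 0)
  have key : ∀ k r i, ‖(T ^ r) (p k) i‖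
      ≤ K * C * Real.exp (∑ m ∈ Finset.range k, K * c * γ ^ m) := by
    intro k
    induction k with
    | zero => intro r i; simpa using hT r (p 0) C hC i
    | succ k ih =>
      intro r i
      set u : ℝ := K * C * Real.exp (∑ m ∈ Finset.range k, K * c * γ ^ m) with hu
      have hu0 : 0 ≤ u := by positivity
      have hsplit : (T ^ r) (p (k + 1))
          = (T ^ (r + 1)) (p k) + (T ^ r) (p (k + 1) - T (p k)) := by
        rw [map_sub, pow_succ, Module.End.mul_apply]
        abel
      have h1 := ih (r + 1) i
      have h2 := hT r _ _ (hp k u fun j => by simpa using ih 0 j) i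
      have h3 : K * c * γ ^ k + 1 ≤ Real.exp (K * c * γ ^ k) := Real.add_one_le_exp _
      rw [hsplit, Pi.add_apply, Finset.sum_range_succ, Real.exp_add, ← mul_assoc, ← hu]
      refine (norm_add_le_of_le h1 h2).trans ?_
      nlinarith [mul_le_mul_of_nonneg_left h3 hu0]
  refine ⟨K * C * Real.exp (K * c * (1 - γ)⁻¹), fun k i => ?_⟩
  refine (by simpa using key k 0 i : ‖p k i‖ ≤ _).trans ?_
  gcongr
  rw [← Finset.mul_sum]
  gcongr
  rw [← tsum_geometric_of_lt_one hγ₀.le hγ₁]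
  exact (summable_geometric_of_lt_one hγ₀.le hγ₁).sum_le_tsum _ fun _ _ => by positivity

theorem norm_sub_pow_apply_le {E : Type*} [NormedAddCommGroup E] [NormedSpace ℝ E]
    {T : Module.End ℝ (ℤ → E)} {K : ℝ}
    (hT : ∀ (k : ℕ) (f : ℤ → E) (D : ℝ), (∀ i, ‖f i‖ ≤ D) → ∀ i, ‖(T ^ k) f i‖ ≤ K * D)
    {p : ℕ → ℤ → E} {δ : ℕ → ℝ} (hp : ∀ (k : ℕ) i, ‖(p (k + 1) - T (p k)) i‖ ≤ δ k)
    (m r s : ℕ) (i : ℤ) :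
    ‖(T ^ s) (p (m + r) - (T ^ r) (p m)) i‖ ≤ ∑ l ∈ Finset.range r, K * δ (m + l) := by
  induction r generalizing s with
  | zero => simp
  | succ r ih =>
    have hsplit : (T ^ s) (p (m + (r + 1)) - (T ^ (r + 1)) (p m))
        = (T ^ (s + 1)) (p (m + r) - (T ^ r) (p m))
          + (T ^ s) (p (m + r + 1) - T (p (m + r))) := by
      rw [← add_assoc, pow_succ T s, Module.End.mul_apply, ← map_add, map_sub T,
        pow_succ' T r, Module.End.mul_apply]
      congr 1
      abel
    rw [hsplit, Pi.add_apply, Finset.sum_range_succ]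
    exact norm_add_le_of_le (ih (s + 1)) (hT s _ _ (hp (m + r)) i)

/-- Two continuous curves both close to the same sequence of samples on fine dyadic grids are
close to each other. -/
theorem norm_sub_le_of_dyadic_approx {E : Type*} [NormedAddCommGroup E]
    {p : ℕ → ℤ → E} {G H : ℝ → E} (hG : Continuous G) (hH : Continuous H) {ε η : ℝ}
    (hpG : ∃ K : ℕ, ∀ k ≥ K, ∀ i : ℤ, ‖p k i - G ((i : ℝ) / 2 ^ k)‖ ≤ ε)
    (hpH : ∃ K : ℕ, ∀ k ≥ K, ∀ i : ℤ, ‖p k i - H ((i : ℝ) / 2 ^ k)‖ ≤ η) (x : ℝ) :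
    ‖G x - H x‖ ≤ ε + η := by
  obtain ⟨K₁, h₁⟩ := hpG
  obtain ⟨K₂, h₂⟩ := hpH
  have hpow : Filter.Tendsto (fun k : ℕ => (2 : ℝ) ^ k) Filter.atTop Filter.atTop :=
    tendsto_pow_atTop_atTop_of_one_lt one_lt_two
  have hx : Filter.Tendsto (fun k : ℕ => ((⌊x * 2 ^ k⌋ : ℤ) : ℝ) / 2 ^ k) Filter.atTop
      (nhds x) := by
    have hinv : Filter.Tendsto (fun k : ℕ => x - ((2 : ℝ) ^ k)⁻¹) Filter.atTop (nhds x) := by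
      simpa using (tendsto_inv_atTop_zero.comp hpow).const_sub x
    refine tendsto_of_tendsto_of_tendsto_of_le_of_le hinv tendsto_const_nhds
      (fun k => ?_) fun k => ?_
    · have hk : (0 : ℝ) < 2 ^ k := by positivity
      simp only
      rw [le_div_iff₀ hk, sub_mul, inv_mul_cancel₀ hk.ne']
      exact (Int.sub_one_lt_floor _).le
    · exact (div_le_iff₀ (by positivity)).2 (Int.floor_le _)
  have hlim := (((hG.sub hH).norm.tendsto x).comp hx)
  refine le_of_tendsto hlim ?_
  filter_upwards [Filter.eventually_ge_atTop (max K₁ K₂)] with k hk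
  have e₁ := h₁ k (le_of_max_le_left hk) ⌊x * 2 ^ k⌋
  have e₂ := h₂ k (le_of_max_le_right hk) ⌊x * 2 ^ k⌋
  rw [norm_sub_rev] at e₁
  exact (norm_sub_le_norm_sub_add_norm_sub _ _ _).trans (add_le_add e₁ e₂)

/-- Samples that can be approximated arbitrarily well by continuous curves converge to a
continuous curve. -/
theorem exists_continuous_limit_of_approx {E : Type*} [NormedAddCommGroup E] [CompleteSpace E]
    {p : ℕ → ℤ → E}
    (h : ∀ ε > (0 : ℝ), ∃ G : ℝ → E, Continuous G ∧
      ∃ K : ℕ, ∀ k ≥ K, ∀ i : ℤ, ‖p k i - G ((i : ℝ) / 2 ^ k)‖ ≤ ε) :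
    ∃ P : ℝ → E, Continuous P ∧ ∀ ε > (0 : ℝ), ∃ K : ℕ, ∀ k ≥ K, ∀ i : ℤ,
      ‖p k i - P ((i : ℝ) / 2 ^ k)‖ ≤ ε := by
  choose G hG hpG using fun m : ℕ => h (1 / (m + 1)) Nat.one_div_pos_of_nat
  have hclose := fun m m' => norm_sub_le_of_dyadic_approx (hG m) (hG m') (hpG m) (hpG m')
  have htend := tendsto_one_div_add_atTop_nhds_zero_nat (𝕜 := ℝ)
  have hcauchy : ∀ x, CauchySeq fun m => G m x := by
    intro x
    refine Metric.cauchySeq_iff.2 fun ε hε => ?_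
    obtain ⟨N, hN⟩ := Filter.eventually_atTop.1 (htend.eventually_lt_const (half_pos hε))
    refine ⟨N, fun m hm m' hm' => ?_⟩
    rw [dist_eq_norm]
    linarith [hclose m m' x, hN m hm, hN m' hm']
  choose P hP using fun x => cauchySeq_tendsto_of_complete (hcauchy x)
  have hGP : ∀ m x, ‖G m x - P x‖ ≤ 1 / ((m : ℝ) + 1) := by
    intro m x
    refine le_of_tendsto_of_tendsto ((tendsto_const_nhds.sub (hP x)).norm)
      (by simpa only [add_zero] using htend.const_add (1 / ((m : ℝ) + 1)))
      (Filter.Eventually.of_forall fun m' => hclose m m' x)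
  have hunif : TendstoUniformly G P Filter.atTop := by
    refine Metric.tendstoUniformly_iff.2 fun ε hε => ?_
    filter_upwards [htend.eventually_lt_const hε] with m hm x
    rw [dist_comm, dist_eq_norm]
    exact (hGP m x).trans_lt hm
  refine ⟨P, hunif.continuous (Filter.Frequently.of_forall hG), fun ε hε => ?_⟩
  obtain ⟨m, hm⟩ := (htend.eventually_lt_const (half_pos hε)).exists
  obtain ⟨K, hK⟩ := hpG m
  refine ⟨K, fun k hk i => ?_⟩
  linarith [norm_sub_le_norm_sub_add_norm_sub (p k i) (G m ((i : ℝ) / 2 ^ k))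
    (P ((i : ℝ) / 2 ^ k)), hK k hk i, hGP m ((i : ℝ) / 2 ^ k)]

/-- Convergence of the univariate PN subdivision scheme (second
assertion of Theorem 1).  If the linear scheme `S_a` is convergent (`C⁰`), and the
subdivided unit normals `n^k` satisfy the local contraction and nonnegative inner
product conditions, then for every bounded initial sequence `p⁰` the PN subdivision
sequence `p_i^{k+1} = Σ_j a_{i−2j} M_{ij}^k p_j^k` converges uniformly to a
continuous limit curve `P`. -/
theorem pn_univariate_convergence
    (B : ℕ) (a : ℤ → ℝ) (hsupp : ∀ i : ℤ, a i ≠ 0 → |i| ≤ (B : ℤ))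
    (heven : ∑ᶠ j : ℤ, a (2 * j) = 1) (hodd : ∑ᶠ j : ℤ, a (2 * j + 1) = 1)
    (hconv : ∀ f0 : ℤ → EuclideanSpace ℝ (Fin d), (∃ C : ℝ, ∀ i : ℤ, ‖f0 i‖ ≤ C) →
      ∃ F : ℝ → EuclideanSpace ℝ (Fin d), Continuous F ∧
        ∀ ε > (0 : ℝ), ∃ K : ℕ, ∀ k ≥ K, ∀ i : ℤ,
          ‖(Sop a)^[k] f0 i - F ((i : ℝ) / 2 ^ k)‖ ≤ ε)
    (n : ℕ → ℤ → EuclideanSpace ℝ (Fin d))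
    (hunit : ∀ (k : ℕ) (j : ℤ), ‖n k j‖ = 1)
    (c₁ γ : ℝ) (hc₁ : 0 < c₁) (hγ₀ : 0 < γ) (hγ₁ : γ < 1)
    (hclose : ∀ (k : ℕ) (j l : ℤ), |j - l| ≤ 2 * (B : ℤ) → ‖n k j - n k l‖ ≤ c₁ * γ ^ k)
    (hinner : ∀ (k : ℕ) (i j : ℤ), a (i - 2 * j) ≠ 0 → 0 ≤ ⟪n (k + 1) i, n k j⟫)
    (p : ℕ → ℤ → EuclideanSpace ℝ (Fin d))
    (hbdd : ∃ C : ℝ, ∀ i : ℤ, ‖p 0 i‖ ≤ C)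
    (hrec : ∀ (k : ℕ) (i : ℤ),
      p (k + 1) i = ∑ᶠ j : ℤ, a (i - 2 * j) • pnM a n k i j (p k j)) :
    ∃ P : ℝ → EuclideanSpace ℝ (Fin d), Continuous P ∧
      ∀ ε > (0 : ℝ), ∃ K : ℕ, ∀ k ≥ K, ∀ i : ℤ,
        ‖p k i - P ((i : ℝ) / 2 ^ k)‖ ≤ ε := by
  obtain ⟨K, hK, hpow⟩ := exists_norm_SopLin_pow_le hsupp hconv (hunit 0 0)
  set T := SopLin (d := d) hsupp with hTdef
  set c : ℝ := 3 * maskBound B a ^ 2 * c₁ with hcdef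
  have hc : 0 ≤ c := by positivity
  have hstep : ∀ (k : ℕ) (D : ℝ), (∀ j, ‖p k j‖ ≤ D) →
      ∀ i, ‖(p (k + 1) - T (p k)) i‖ ≤ c * γ ^ k * D := by
    intro k D hD i
    rw [Pi.sub_apply, hrec]
    exact (norm_finsum_pnM_sub_Sop_le hsupp hunit k (hclose k) (hinner k) hD i).trans_eq
      (by rw [hcdef]; ring)
  obtain ⟨D, hD⟩ := exists_bound_of_perturbed_iteration hK hpow hc hγ₀ hγ₁ hstep hbdd
  have hD0 : 0 ≤ D := (norm_nonneg _).trans (hD 0 0)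
  have htail : ∀ m r i, ‖p (m + r) i - (T ^ r) (p m) i‖
      ≤ K * c * D * (1 - γ)⁻¹ * γ ^ m := by
    intro m r i
    have h := norm_sub_pow_apply_le hpow (fun k => hstep k D (hD k)) m r 0 i
    rw [pow_zero, Module.End.one_apply, Pi.sub_apply] at h
    refine h.trans ?_
    have hsum : ∑ l ∈ Finset.range r, γ ^ l ≤ (1 - γ)⁻¹ := by
      rw [← tsum_geometric_of_lt_one hγ₀.le hγ₁]
      exact (summable_geometric_of_lt_one hγ₀.le hγ₁).sum_le_tsum _ fun _ _ => by positivity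
    calc ∑ l ∈ Finset.range r, K * (c * γ ^ (m + l) * D)
        = K * c * D * γ ^ m * ∑ l ∈ Finset.range r, γ ^ l := by
          rw [Finset.mul_sum]
          exact Finset.sum_congr rfl fun l _ => by ring
      _ ≤ K * c * D * γ ^ m * (1 - γ)⁻¹ := by gcongr
      _ = K * c * D * (1 - γ)⁻¹ * γ ^ m := by ring
  refine exists_continuous_limit_of_approx fun ε hε => ?_
  have htend : Filter.Tendsto (fun m : ℕ => K * c * D * (1 - γ)⁻¹ * γ ^ m) Filter.atTop
      (nhds 0) := by
    simpa using (tendsto_pow_atTop_nhds_zero_of_lt_one hγ₀.le hγ₁).const_mul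
      (K * c * D * (1 - γ)⁻¹)
  obtain ⟨m, hm⟩ := (htend.eventually_lt_const (half_pos hε)).exists
  obtain ⟨F, hF, hlim⟩ := hconv (p m) ⟨D, hD m⟩
  obtain ⟨N, hN⟩ := hlim (ε / 2) (half_pos hε)
  refine ⟨fun x => F (2 ^ m * x), by fun_prop, m + N, fun k hk i => ?_⟩
  obtain ⟨r, rfl⟩ := Nat.exists_eq_add_of_le ((Nat.le_add_right m N).trans hk)
  have h1 := hN r (by omega) i
  have hx : (2 : ℝ) ^ m * ((i : ℝ) / 2 ^ (m + r)) = (i : ℝ) / 2 ^ r := by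
    rw [pow_add]
    field_simp
  rw [← SopLin_pow_apply hsupp] at h1
  simp only [hx]
  linarith [norm_sub_le_norm_sub_add_norm_sub (p (m + r) i) ((T ^ r) (p m) i)
    (F ((i : ℝ) / 2 ^ r)), htail m r i]
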